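/- The rule δ_H* is minimax optimal in terms of mean square regret for the two-dimensional partially identified problem: for every measurable rule δ : ℝ → [0,1], sup_{(θ_e,θ_t)∈Θ} R_sq(δ, θ_e, θ_t) ≥ sup_{(θ_e,θ_t)∈Θ} R_sq(δ_H*, θ_e, θ_t). -/

import Mathlib

open Real MeasureTheory

/-- The standard normal density. -/
noncomputable def gaussPdf (x : ℝ) : ℝ :=
  (Real.sqrt (2 * Real.pi))⁻¹ * Real.exp (-(x ^ 2) / 2)

/-- ρ(a) = ∫ (1/(exp(2ay)+1))² φ(y−a) dy. -/
noncomputable def ρ (a : ℝ) : ℝ :=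
  ∫ y : ℝ, (1 / (Real.exp (2 * a * y) + 1)) ^ 2 * gaussPdf (y - a)

/-- Mean square regret in the two-dimensional partially identified problem:
data X ~ N(θ_e, σ²), target effect θ_t. -/
noncomputable def Rsq (σ : ℝ) (δ : ℝ → ℝ) (θe θt : ℝ) : ℝ :=
  θt ^ 2 *
    ∫ x : ℝ, ((if 0 ≤ θt then (1 : ℝ) else 0) - δ x) ^ 2 *
      (σ⁻¹ * gaussPdf ((x - θe) / σ))

/-- The parameter space Θ = {(θ_e, θ_t) : θ_e − k ≤ θ_t ≤ θ_e + k}. -/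
def Θset (k : ℝ) : Set (ℝ × ℝ) := {p | p.1 - k ≤ p.2 ∧ p.2 ≤ p.1 + k}

theorem gaussPdf_pos (x : ℝ) : 0 < gaussPdf x := by
  unfold gaussPdf; positivity

theorem gaussPdf_neg (x : ℝ) : gaussPdf (-x) = gaussPdf x := by
  simp [gaussPdf]

theorem continuous_gaussPdf : Continuous gaussPdf := by
  unfold gaussPdf; fun_prop

theorem integrable_gaussPdf : Integrable gaussPdf := by
  have h := (integrable_exp_neg_mul_sq (b := 1 / 2) (by norm_num)).const_mul (√(2 * π))⁻¹
  refine h.congr (ae_of_all _ fun x => ?_)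
  simp only [gaussPdf]
  ring_nf

theorem integrable_mul_gaussPdf_sub {f : ℝ → ℝ} (hf : Measurable f) (h : ∀ x, f x ∈ Set.Icc 0 1)
    (t : ℝ) : Integrable fun y => f y * gaussPdf (y - t) := by
  refine (integrable_gaussPdf.comp_sub_right t).bdd_mul (c := 1) hf.aestronglyMeasurable ?_
  refine ae_of_all _ fun x => ?_
  rw [Real.norm_eq_abs, abs_of_nonneg (h x).1]
  exact (h x).2

/-- Exchange inequality for products of integrals. -/
theorem integral_mul_integral_le {a b c d : ℝ → ℝ} (ha : Integrable a) (hb : Integrable b)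
    (hc : Integrable c) (hd : Integrable d)
    (h : ∀ y z, a y * d z + d y * a z ≤ b y * c z + c y * b z) :
    (∫ y, a y) * ∫ y, d y ≤ (∫ y, b y) * ∫ y, c y := by
  have key : ∫ w : ℝ × ℝ, (a w.1 * d w.2 + d w.1 * a w.2) ∂(volume.prod volume) ≤
      ∫ w : ℝ × ℝ, (b w.1 * c w.2 + c w.1 * b w.2) ∂(volume.prod volume) :=
    integral_mono ((ha.mul_prod hd).add (hd.mul_prod ha)) ((hb.mul_prod hc).add (hc.mul_prod hb))
      fun w => h w.1 w.2
  rw [integral_add (ha.mul_prod hd) (hd.mul_prod ha),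
    integral_add (hb.mul_prod hc) (hc.mul_prod hb)] at key
  have e (f g : ℝ → ℝ) : ∫ w : ℝ × ℝ, f w.1 * g w.2 ∂(volume.prod volume) = (∫ y, f y) * ∫ y, g y :=
    integral_prod_mul f g
  simp only [e] at key
  linarith

/-- The squared probability with which the logistic rule of slope `2a` rejects treatment. -/
noncomputable def sqLogistic (a y : ℝ) : ℝ := (1 / (Real.exp (2 * a * y) + 1)) ^ 2

theorem continuous_sqLogistic (a : ℝ) : Continuous (sqLogistic a) := by
  unfold sqLogistic
  have (y : ℝ) : Real.exp (2 * a * y) + 1 ≠ 0 := by positivity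
  fun_prop (disch := assumption)

theorem sqLogistic_pos (a y : ℝ) : 0 < sqLogistic a y := by
  unfold sqLogistic; positivity

theorem sqLogistic_mem (a y : ℝ) : sqLogistic a y ∈ Set.Icc 0 1 := by
  refine ⟨(sqLogistic_pos a y).le, ?_⟩
  have : 0 < Real.exp (2 * a * y) := Real.exp_pos _
  refine pow_le_one₀ (by positivity) ?_
  rw [div_le_one (by positivity)]
  linarith

theorem sqLogistic_antitone {a : ℝ} (ha : 0 ≤ a) : Antitone (sqLogistic a) := by
  intro x y hxy
  unfold sqLogistic
  gcongr

theorem sqLogistic_mul_le {a y z u : ℝ} (ha : 0 ≤ a) (hu : 0 ≤ u) (hzy : z ≤ y) :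
    sqLogistic a (y + u) * sqLogistic a z ≤ sqLogistic a y * sqLogistic a (z + u) := by
  unfold sqLogistic
  rw [← mul_pow, ← mul_pow, div_mul_div_comm, div_mul_div_comm]
  have h1 : Real.exp (2 * a * z) ≤ Real.exp (2 * a * y) := by gcongr
  have h2 : 1 ≤ Real.exp (2 * a * u) := Real.one_le_exp (by positivity)
  gcongr ?_ ^ 2
  apply div_le_div_of_nonneg_left (by norm_num) (by positivity)
  rw [mul_add (2 * a) z, mul_add (2 * a) y, Real.exp_add, Real.exp_add]
  nlinarith [mul_nonneg (sub_nonneg.2 h1) (sub_nonneg.2 h2)]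

theorem gaussPdf_mul_le {y z s t : ℝ} (hst : s ≤ t) (hzy : z ≤ y) :
    gaussPdf (z - t) * gaussPdf (y - s) ≤ gaussPdf (y - t) * gaussPdf (z - s) := by
  unfold gaussPdf
  rw [mul_mul_mul_comm, mul_mul_mul_comm _ _ (√(2 * π))⁻¹, ← Real.exp_add, ← Real.exp_add]
  refine mul_le_mul_of_nonneg_left (Real.exp_le_exp.2 ?_) (by positivity)
  nlinarith [mul_nonneg (sub_nonneg.2 hst) (sub_nonneg.2 hzy)]

/-- The expected squared rejection probability of the logistic rule at location `t`. -/
noncomputable def logisticRisk (a t : ℝ) : ℝ := ∫ y : ℝ, sqLogistic a y * gaussPdf (y - t)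

theorem integrable_logisticRisk (a t : ℝ) :
    Integrable fun y => sqLogistic a y * gaussPdf (y - t) :=
  integrable_mul_gaussPdf_sub (continuous_sqLogistic a).measurable (sqLogistic_mem a) t

theorem integrable_logisticRisk_shift (a t u : ℝ) :
    Integrable fun y => sqLogistic a (y + u) * gaussPdf (y - t) :=
  integrable_mul_gaussPdf_sub ((continuous_sqLogistic a).comp (continuous_add_const u)).measurable
    (fun _ => sqLogistic_mem a _) t

theorem logisticRisk_add (a t u : ℝ) :
    logisticRisk a (t + u) = ∫ y, sqLogistic a (y + u) * gaussPdf (y - t) := by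
  unfold logisticRisk
  rw [← integral_add_right_eq_self _ u]
  simp [add_sub_add_right_eq_sub]

theorem logisticRisk_pos (a t : ℝ) : 0 < logisticRisk a t := by
  refine integral_pos_of_integrable_nonneg_nonzero (x := 0)
    ((continuous_sqLogistic a).mul (continuous_gaussPdf.comp (continuous_sub_right t)))
    (integrable_logisticRisk a t)
    (fun y => mul_nonneg (sqLogistic_pos a y).le (gaussPdf_pos _).le) ?_
  exact (mul_pos (sqLogistic_pos a 0) (gaussPdf_pos _)).ne'

theorem logisticRisk_antitone {a : ℝ} (ha : 0 ≤ a) : Antitone (logisticRisk a) := by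
  intro s t hst
  have e (u : ℝ) := logisticRisk_add a 0 u
  simp only [zero_add] at e
  rw [e, e]
  refine integral_mono (integrable_logisticRisk_shift a 0 t) (integrable_logisticRisk_shift a 0 s)
    fun y => ?_
  exact mul_le_mul_of_nonneg_right (sqLogistic_antitone ha (by linarith)) (gaussPdf_pos _).le

theorem logisticRisk_mul_le {a : ℝ} (ha : 0 ≤ a) (x u : ℝ) :
    logisticRisk a (x + u) * logisticRisk a (x - u) ≤ logisticRisk a x ^ 2 := by
  wlog hu : 0 ≤ u generalizing u
  · have := this (-u) (by linarith)
    rwa [sub_neg_eq_add, ← sub_eq_add_neg, mul_comm] at this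
  have hx : logisticRisk a x = ∫ y, sqLogistic a (y + u) * gaussPdf (y - (x - u)) := by
    rw [← logisticRisk_add, sub_add_cancel]
  rw [sq, logisticRisk_add]
  nth_rewrite 2 [hx]
  refine integral_mul_integral_le (integrable_logisticRisk_shift a x u)
    (integrable_logisticRisk a x) (integrable_logisticRisk_shift a _ u)
    (integrable_logisticRisk a _) fun y z => ?_
  rcases le_total z y with h | h
  · nlinarith [mul_nonneg (sub_nonneg.2 (sqLogistic_mul_le ha hu h))
      (sub_nonneg.2 (gaussPdf_mul_le (sub_le_self x hu) h))]
  · nlinarith [mul_nonneg (sub_nonneg.2 (sqLogistic_mul_le ha hu h))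
      (sub_nonneg.2 (gaussPdf_mul_le (sub_le_self x hu) h))]

/-! ### The Bayes risk of the symmetric two-point prior -/

theorem gaussPdf_sub (y b : ℝ) :
    gaussPdf (y - b) = Real.exp (-(b ^ 2) / 2) * gaussPdf y * Real.exp (b * y) := by
  unfold gaussPdf
  rw [mul_left_comm, mul_assoc, ← Real.exp_add, ← Real.exp_add]
  ring_nf

theorem gaussPdf_add (y b : ℝ) :
    gaussPdf (y + b) = Real.exp (-(b ^ 2) / 2) * gaussPdf y * Real.exp (-(b * y)) := by
  have := gaussPdf_sub y (-b)
  simpa using this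

theorem integrable_mul_gaussPdf_add {f : ℝ → ℝ} (hf : Measurable f) (h : ∀ x, f x ∈ Set.Icc 0 1)
    (t : ℝ) : Integrable fun y => f y * gaussPdf (y + t) := by
  simpa using integrable_mul_gaussPdf_sub hf h (-t)

theorem continuous_inv_cosh_mul (b : ℝ) : Continuous fun y : ℝ => (Real.cosh (b * y))⁻¹ :=
  (Real.continuous_cosh.comp (continuous_const_mul b)).inv₀ fun _ => (Real.cosh_pos _).ne'

theorem integrable_inv_cosh_mul_gaussPdf (b : ℝ) :
    Integrable fun y => (Real.cosh (b * y))⁻¹ * gaussPdf y := by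
  have := integrable_mul_gaussPdf_sub (f := fun y => (Real.cosh (b * y))⁻¹)
    (continuous_inv_cosh_mul b).measurable
    (fun y => ⟨(inv_pos.2 (Real.cosh_pos _)).le, inv_le_one_of_one_le₀ (Real.one_le_cosh _)⟩) 0
  simpa using this

theorem integral_neg_logisticRisk (a t : ℝ) :
    ∫ y, sqLogistic a (-y) * gaussPdf (y + t) = logisticRisk a t := by
  unfold logisticRisk
  rw [← integral_neg_eq_self]
  congr 1 with y
  rw [← gaussPdf_neg (-y + t), neg_neg]
  ring_nf

theorem bayes_pointwise (b y d : ℝ) :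
    (Real.exp (-(b ^ 2) / 2) / 2) * ((Real.cosh (b * y))⁻¹ * gaussPdf y) ≤
      (1 - d) ^ 2 * gaussPdf (y - b) + d ^ 2 * gaussPdf (y + b) := by
  rw [gaussPdf_sub, gaussPdf_add, Real.cosh_eq, Real.exp_neg (b * y)]
  have hw := Real.exp_pos (b * y)
  have hc := mul_pos (Real.exp_pos (-(b ^ 2) / 2)) (gaussPdf_pos y)
  set w := Real.exp (b * y)
  have : (w / (w ^ 2 + 1)) ≤ (1 - d) ^ 2 * w + d ^ 2 * w⁻¹ := by
    rw [← sub_nonneg]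
    have : (1 - d) ^ 2 * w + d ^ 2 * w⁻¹ - w / (w ^ 2 + 1) =
      (w ^ 2 - d * (w ^ 2 + 1)) ^ 2 / (w * (w ^ 2 + 1)) := by
      field_simp
      ring
    rw [this]
    positivity
  calc _ = (Real.exp (-(b ^ 2) / 2) * gaussPdf y) * (w / (w ^ 2 + 1)) := by
        field_simp
    _ ≤ (Real.exp (-(b ^ 2) / 2) * gaussPdf y) * ((1 - d) ^ 2 * w + d ^ 2 * w⁻¹) := by gcongr
    _ = _ := by ring

theorem bayes_pointwise_eq (b y : ℝ) :
    sqLogistic b y * gaussPdf (y - b) + sqLogistic b (-y) * gaussPdf (y + b) =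
    (Real.exp (-(b ^ 2) / 2) / 2) * ((Real.cosh (b * y))⁻¹ * gaussPdf y) := by
  have h1 : Real.exp (2 * b * y) = Real.exp (b * y) ^ 2 := by
    rw [← Real.exp_nat_mul]; ring_nf
  have h2 : Real.exp (2 * b * -y) = (Real.exp (b * y) ^ 2)⁻¹ := by
    rw [← h1, ← Real.exp_neg]; ring_nf
  unfold sqLogistic
  rw [gaussPdf_sub, gaussPdf_add, Real.cosh_eq, Real.exp_neg (b * y), h1, h2]
  have hw := Real.exp_pos (b * y)
  set w := Real.exp (b * y)
  field_simp
  ring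

theorem two_mul_rho (b : ℝ) :
    2 * ρ b = (Real.exp (-(b ^ 2) / 2) / 2) * ∫ y, (Real.cosh (b * y))⁻¹ * gaussPdf y := by
  rw [← integral_const_mul]
  simp_rw [← bayes_pointwise_eq]
  rw [integral_add (integrable_logisticRisk b b), integral_neg_logisticRisk]
  · change _ = ρ b + ρ b
    ring
  · exact integrable_mul_gaussPdf_add (f := fun y => sqLogistic b (-y))
      ((continuous_sqLogistic b).comp continuous_neg).measurable (fun _ => sqLogistic_mem _ _) b

theorem two_mul_rho_le {δ : ℝ → ℝ} (hδ : Measurable δ) (h : ∀ x, δ x ∈ Set.Icc 0 1) (b : ℝ) :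
    2 * ρ b ≤ (∫ y, (1 - δ y) ^ 2 * gaussPdf (y - b)) + ∫ y, δ y ^ 2 * gaussPdf (y + b) := by
  have h1 : Integrable fun y => (1 - δ y) ^ 2 * gaussPdf (y - b) :=
    integrable_mul_gaussPdf_sub (f := fun y => (1 - δ y) ^ 2) (by fun_prop)
      (fun x => ⟨sq_nonneg _, pow_le_one₀ (by linarith [(h x).2]) (by linarith [(h x).1])⟩) b
  have h2 : Integrable fun y => δ y ^ 2 * gaussPdf (y + b) :=
    integrable_mul_gaussPdf_add (f := fun y => δ y ^ 2) (by fun_prop)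
      (fun x => ⟨sq_nonneg _, pow_le_one₀ (h x).1 (h x).2⟩) b
  rw [two_mul_rho, ← integral_const_mul, ← integral_add h1 h2]
  exact integral_mono ((integrable_inv_cosh_mul_gaussPdf b).const_mul _) (h1.add h2)
    fun y => bayes_pointwise b y (δ y)

theorem one_sub_logistic_sq (a y : ℝ) :
    (1 - Real.exp (2 * a * y) / (Real.exp (2 * a * y) + 1)) ^ 2 = sqLogistic a y := by
  unfold sqLogistic
  congr 1
  field_simp
  ring

theorem logistic_sq (a y : ℝ) :
    (Real.exp (2 * a * y) / (Real.exp (2 * a * y) + 1)) ^ 2 = sqLogistic a (-y) := by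
  unfold sqLogistic
  rw [mul_neg, Real.exp_neg]
  congr 1
  field_simp
  ring

theorem logistic_mem (a y : ℝ) :
    Real.exp (2 * a * y) / (Real.exp (2 * a * y) + 1) ∈ Set.Icc 0 1 := by
  refine ⟨by positivity, ?_⟩
  rw [div_le_one (by positivity)]
  linarith

theorem rho_le_logisticRisk (a b : ℝ) : ρ b ≤ logisticRisk a b := by
  have hm : Measurable fun y : ℝ => Real.exp (2 * a * y) / (Real.exp (2 * a * y) + 1) := by
    fun_prop
  have := two_mul_rho_le hm (logistic_mem a) b
  simp only [one_sub_logistic_sq, logistic_sq, integral_neg_logisticRisk] at this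
  unfold logisticRisk at *
  linarith

theorem rho_eq_logisticRisk (a : ℝ) : ρ a = logisticRisk a a := rfl

theorem rho_pos (a : ℝ) : 0 < ρ a := logisticRisk_pos a a

theorem rho_neg (b : ℝ) : ρ (-b) = ρ b := by
  have h1 := two_mul_rho b
  have h2 := two_mul_rho (-b)
  simp only [neg_mul, Real.cosh_neg, neg_sq] at h2
  linarith

theorem integrable_abs_mul_gaussPdf : Integrable fun y => |y| * gaussPdf y := by
  have h := ((integrable_mul_exp_neg_mul_sq (b := 1 / 2) (by norm_num)).const_mul (√(2 * π))⁻¹).abs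
  refine h.congr (ae_of_all _ fun x => ?_)
  simp only [gaussPdf, abs_mul, Real.abs_exp, abs_of_nonneg (inv_nonneg.2 (Real.sqrt_nonneg _))]
  ring_nf

theorem differentiable_rho : Differentiable ℝ ρ := by
  have hI : Differentiable ℝ fun b : ℝ => ∫ y, (Real.cosh (b * y))⁻¹ * gaussPdf y := by
    intro b
    refine (hasDerivAt_integral_of_dominated_loc_of_deriv_le (x₀ := b) (s := Set.univ)
      (F := fun b y => (Real.cosh (b * y))⁻¹ * gaussPdf y)
      (F' := fun b y => (-(Real.sinh (b * y) * y) / Real.cosh (b * y) ^ 2) * gaussPdf y)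
      (bound := fun y => |y| * gaussPdf y) Filter.univ_mem
      (Filter.Eventually.of_forall fun b => (integrable_inv_cosh_mul_gaussPdf b).1)
      (integrable_inv_cosh_mul_gaussPdf b) ?_ ?_ integrable_abs_mul_gaussPdf
      ?_).2.differentiableAt
    · refine Continuous.aestronglyMeasurable ?_
      have (y : ℝ) : Real.cosh (b * y) ^ 2 ≠ 0 := pow_ne_zero _ (Real.cosh_pos _).ne'
      have := continuous_gaussPdf
      have := Real.continuous_sinh
      have := Real.continuous_cosh
      fun_prop (disch := assumption)
    · refine ae_of_all _ fun y x _ => ?_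
      rw [norm_mul, Real.norm_of_nonneg (gaussPdf_pos y).le]
      refine mul_le_mul_of_nonneg_right ?_ (gaussPdf_pos y).le
      have hc := Real.cosh_pos (x * y)
      rw [norm_div, norm_neg, norm_mul, norm_pow, Real.norm_of_nonneg hc.le, Real.norm_eq_abs,
        Real.norm_eq_abs, div_le_iff₀ (by positivity), mul_comm]
      refine mul_le_mul_of_nonneg_left ?_ (abs_nonneg y)
      refine abs_le_of_sq_le_sq ?_ (by positivity)
      nlinarith [Real.cosh_sq (x * y), sq_nonneg (Real.sinh (x * y))]
    · refine ae_of_all _ fun y x _ => ?_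
      have h1 : HasDerivAt (fun x : ℝ => x * y) y x := hasDerivAt_mul_const y
      exact ((h1.cosh).inv (Real.cosh_pos _).ne').mul_const _
  have : ρ = fun b => (Real.exp (-(b ^ 2) / 2) / 4) *
      ∫ y, (Real.cosh (b * y))⁻¹ * gaussPdf y := by
    ext b
    linarith [two_mul_rho b]
  rw [this]
  have h2 : Differentiable ℝ fun b : ℝ => Real.exp (-(b ^ 2) / 2) / 4 := by fun_prop
  exact h2.mul hI

theorem deriv_rho_zero : deriv ρ 0 = 0 := by
  have h := deriv_comp_neg ρ 0
  simp only [rho_neg, neg_zero] at h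
  linarith

/-! ### First-order conditions -/

theorem tendsto_nat_mul_sub {f : ℝ → ℝ} {d a : ℝ} (h : HasDerivAt f d a) (v : ℝ) :
    Filter.Tendsto (fun n : ℕ => (n : ℝ) * (f (a + v / n) - f a)) Filter.atTop (nhds (v * d)) := by
  have h1 : HasDerivAt (fun s : ℝ => f (a + v * s)) (d * v) 0 := by
    have h2 : HasDerivAt (fun s : ℝ => a + v * s) v 0 := by
      simpa using ((hasDerivAt_id (0 : ℝ)).const_mul v).const_add a
    refine HasDerivAt.comp (0 : ℝ) ?_ h2
    simpa using h
  have h3 := h1.tendsto_slope.comp (tendsto_nhdsWithin_iff.2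
    ⟨tendsto_inv_atTop_nhds_zero_nat (𝕜 := ℝ), (Filter.eventually_gt_atTop 0).mono fun n hn => by
      simp [hn.ne']⟩)
  rw [mul_comm d v] at h3
  refine h3.congr fun n => ?_
  simp [slope_def_field, div_eq_mul_inv, mul_comm]

theorem tendsto_add_div_nat (a v : ℝ) :
    Filter.Tendsto (fun n : ℕ => a + v / n) Filter.atTop (nhds a) := by
  simpa using (tendsto_const_div_atTop_nhds_zero_nat v).const_add a

theorem mul_deriv_nonpos {f : ℝ → ℝ} {d a l u v : ℝ} (h : HasDerivAt f d a)
    (ha : a ∈ Set.Icc l u) (hv : a + v ∈ Set.Icc l u) (hmax : ∀ x ∈ Set.Icc l u, f x ≤ f a) :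
    v * d ≤ 0 := by
  refine le_of_tendsto (tendsto_nat_mul_sub h v)
    ((Filter.eventually_gt_atTop 0).mono fun n hn => ?_)
  have hn1 : (1 : ℝ) ≤ n := by exact_mod_cast hn
  refine mul_nonpos_of_nonneg_of_nonpos (by positivity) (sub_nonpos.2 (hmax _ ?_))
  have := (convex_Icc l u).add_smul_mem ha hv (t := (n : ℝ)⁻¹)
    ⟨by positivity, inv_le_one_of_one_le₀ hn1⟩
  rwa [smul_eq_mul, mul_comm, ← div_eq_mul_inv] at this

theorem hasDerivAt_sq_mul_rho (c x : ℝ) :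
    HasDerivAt (fun x => (x + c) ^ 2 * ρ x) (2 * (x + c) * ρ x + (x + c) ^ 2 * deriv ρ x) x := by
  have h1 : HasDerivAt (fun x : ℝ => (x + c) ^ 2) (2 * (x + c)) x := by
    simpa using ((hasDerivAt_id x).add_const c).fun_pow 2
  exact h1.mul (differentiable_rho x).hasDerivAt

/-- A maximizer of `(x + c)² ρ(x)` over `[0, τ]` is interior, so the derivative vanishes there. -/
theorem hasDerivAt_zero_of_max {c τ a : ℝ} (hc : 0 < c) (hτ0 : 0 ≤ τ)
    (hτ : ∀ t, 0 ≤ t → t ^ 2 * ρ t ≤ τ ^ 2 * ρ τ) (ha : a ∈ Set.Icc 0 τ)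
    (hmax : ∀ x ∈ Set.Icc 0 τ, (x + c) ^ 2 * ρ x ≤ (a + c) ^ 2 * ρ a) :
    0 < a ∧ HasDerivAt (fun x => (x + c) ^ 2 * ρ x) 0 a := by
  have hτpos : 0 < τ := by
    refine hτ0.lt_of_ne fun h => ?_
    have := hτ 1 zero_le_one
    rw [← h] at this
    linarith [rho_pos 1]
  have hτd : 2 * τ * ρ τ + τ ^ 2 * deriv ρ τ = 0 := by
    have h := hasDerivAt_sq_mul_rho 0 τ
    simp only [add_zero] at h
    refine IsLocalMax.hasDerivAt_eq_zero ?_ h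
    filter_upwards [lt_mem_nhds hτpos] with x hx using hτ x hx.le
  have hd := hasDerivAt_sq_mul_rho c a
  have h0 : 0 < a := by
    refine ha.1.lt_of_ne fun h => ?_
    subst h
    have := mul_deriv_nonpos (v := τ) hd ha (by simpa using hτ0) hmax
    rw [deriv_rho_zero] at this
    have : 0 < τ * (2 * (0 + c) * ρ 0 + (0 + c) ^ 2 * 0) := by
      have := rho_pos 0
      rw [mul_zero, add_zero, zero_add]
      positivity
    linarith
  have h1 : a < τ := by
    refine ha.2.lt_of_ne fun h => ?_
    subst h
    have h2 := mul_deriv_nonpos (v := -a) hd ha (by simpa using hτ0) hmax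
    have h3 : deriv ρ a = - (2 * ρ a / a) := by
      field_simp
      nlinarith
    rw [h3] at h2
    have h4 : -a * (2 * (a + c) * ρ a + (a + c) ^ 2 * -(2 * ρ a / a)) =
        2 * c * (a + c) * ρ a := by
      field_simp
      ring
    have := rho_pos a
    have : 0 < 2 * c * (a + c) * ρ a := by positivity
    linarith
  refine ⟨h0, ?_⟩
  have h2 : IsLocalMax (fun x => (x + c) ^ 2 * ρ x) a := by
    filter_upwards [Icc_mem_nhds h0 h1] with x hx using hmax x hx
  rwa [h2.hasDerivAt_eq_zero hd] at hd

theorem sub_le_nat_mul_sub {ℓ : ℕ → ℝ} {m : ℝ} (n : ℕ) (h0 : 0 < n → ℓ 1 - ℓ 0 ≤ m)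
    (h : ∀ i, i + 2 ≤ n → ℓ (i + 2) + ℓ i ≤ 2 * ℓ (i + 1)) : ℓ n - ℓ 0 ≤ n * m := by
  have step : ∀ i, i + 1 ≤ n → ℓ (i + 1) - ℓ i ≤ m := by
    intro i
    induction i with
    | zero => exact fun hi => h0 hi
    | succ i ih => exact fun hi => by linarith [ih (by omega), h i hi]
  have sum : ∀ i, i ≤ n → ℓ i - ℓ 0 ≤ i * m := by
    intro i
    induction i with
    | zero => simp
    | succ i ih =>
      intro hi
      push_cast
      linarith [ih (by omega), step i hi]
  exact sum n le_rfl

/-- A midpoint-concave function touched from below at `a` by a function with vanishing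
derivative is maximal at `a`. -/
theorem le_of_midpoint_concave {L s : ℝ → ℝ} {l a t : ℝ} (hla : l < a) (hlt : l < t)
    (hL : ∀ x w, l < x + w → l < x - w → L (x + w) + L (x - w) ≤ 2 * L x)
    (hs : ∀ x, l < x → s x ≤ L x) (hsa : s a = L a) (hd : HasDerivAt s 0 a) : L t ≤ L a := by
  have lim := (tendsto_nat_mul_sub hd (-(t - a))).neg
  rw [mul_zero, neg_zero] at lim
  rw [← sub_nonpos]
  refine ge_of_tendsto lim ?_
  filter_upwards [Filter.eventually_gt_atTop 0,
    (tendsto_add_div_nat a (-(t - a))).eventually (lt_mem_nhds hla)] with n hn hln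
  have hn0 : (0 : ℝ) < n := by exact_mod_cast hn
  set w := (t - a) / n with hw
  have hnw : a + n * w = t := by rw [hw]; field_simp; ring
  rw [neg_div, ← sub_eq_add_neg, ← hw] at *
  have mem (i : ℕ) (hi : i ≤ n) : l < a + i * w := by
    have hi' : (i : ℝ) ≤ n := by exact_mod_cast hi
    have hi0 : (0 : ℝ) ≤ i := by positivity
    rcases le_total 0 w with h | h
    · nlinarith
    · nlinarith
  have key := sub_le_nat_mul_sub (ℓ := fun i => L (a + i * w)) (m := L a - L (a - w)) n
    (fun _ => by
      have := hL a w (by simpa using mem 1 hn) hln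
      simp only [Nat.cast_one, one_mul, Nat.cast_zero, zero_mul, add_zero]
      linarith)
    (fun i hi => by
      have e1 : a + ((i + 2 : ℕ) : ℝ) * w = a + ((i + 1 : ℕ) : ℝ) * w + w := by
        push_cast; ring
      have e2 : a + (i : ℝ) * w = a + ((i + 1 : ℕ) : ℝ) * w - w := by push_cast; ring
      have m1 := mem (i + 2) hi
      have m2 := mem i (by omega)
      rw [e1] at m1
      rw [e2] at m2
      simp only [e1, e2]
      exact hL _ _ m1 m2)
  simp only [hnw, Nat.cast_zero, zero_mul, add_zero] at key
  have := hs _ hln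
  nlinarith

theorem sq_mul_logisticRisk_le {c τ a : ℝ} (hc : 0 < c) (hτ0 : 0 ≤ τ)
    (hτ : ∀ t, 0 ≤ t → t ^ 2 * ρ t ≤ τ ^ 2 * ρ τ) (ha : a ∈ Set.Icc 0 τ)
    (hmax : ∀ x ∈ Set.Icc 0 τ, (x + c) ^ 2 * ρ x ≤ (a + c) ^ 2 * ρ a) {t : ℝ} (ht : -c ≤ t) :
    (t + c) ^ 2 * logisticRisk a t ≤ (a + c) ^ 2 * ρ a := by
  have hρ := rho_pos a
  rcases ht.eq_or_lt with rfl | ht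
  · simp only [neg_add_cancel, ne_eq, OfNat.ofNat_ne_zero, not_false_eq_true, zero_pow, zero_mul]
    positivity
  obtain ⟨ha0, hd⟩ := hasDerivAt_zero_of_max hc hτ0 hτ ha hmax
  have pos (x : ℝ) (hx : -c < x) : 0 < (x + c) ^ 2 * logisticRisk a x :=
    mul_pos (pow_pos (by linarith) 2) (logisticRisk_pos a x)
  have rpos (x : ℝ) (hx : -c < x) : 0 < (x + c) ^ 2 * ρ x :=
    mul_pos (pow_pos (by linarith) 2) (rho_pos x)
  have hla : -c < a := by linarith
  rw [rho_eq_logisticRisk, ← Real.log_le_log_iff (pos t ht) (pos a hla)]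
  refine le_of_midpoint_concave (L := fun x => Real.log ((x + c) ^ 2 * logisticRisk a x))
    (s := fun x => Real.log ((x + c) ^ 2 * ρ x)) hla ht ?_ ?_ rfl ?_
  · intro x w h1 h2
    have h3 : -c < x := by linarith
    rw [← Real.log_mul (pos _ h1).ne' (pos _ h2).ne', ← Nat.cast_ofNat (R := ℝ) (n := 2),
      ← Real.log_pow]
    refine Real.log_le_log (mul_pos (pos _ h1) (pos _ h2)) ?_
    have e1 : 0 ≤ (x + w + c) * (x - w + c) := mul_nonneg (by linarith) (by linarith)
    have e2 : (x + w + c) * (x - w + c) ≤ (x + c) ^ 2 := by nlinarith [sq_nonneg w]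
    calc _ = ((x + w + c) * (x - w + c)) ^ 2 *
          (logisticRisk a (x + w) * logisticRisk a (x - w)) := by ring
      _ ≤ ((x + c) ^ 2) ^ 2 * logisticRisk a x ^ 2 :=
        mul_le_mul (pow_le_pow_left₀ e1 e2 2) (logisticRisk_mul_le ha.1 x w)
          (mul_pos (logisticRisk_pos _ _) (logisticRisk_pos _ _)).le (by positivity)
      _ = _ := by ring
  · intro x hx
    exact Real.log_le_log (rpos x hx)
      (mul_le_mul_of_nonneg_left (rho_le_logisticRisk a x) (sq_nonneg _))
  · simpa using hd.log (rpos a hla).ne'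

theorem Rsq_eq {σ : ℝ} (hσ : 0 < σ) (δ : ℝ → ℝ) (θe θt : ℝ) :
    Rsq σ δ θe θt = θt ^ 2 *
      ∫ y, ((if 0 ≤ θt then (1 : ℝ) else 0) - δ (σ * y)) ^ 2 * gaussPdf (y - θe / σ) := by
  unfold Rsq
  congr 1
  have h := Measure.integral_comp_mul_left (fun x => ((if 0 ≤ θt then (1 : ℝ) else 0) - δ x) ^ 2 *
      gaussPdf ((x - θe) / σ)) σ
  have e (y : ℝ) : (σ * y - θe) / σ = y - θe / σ := by field_simp
  simp only [e] at h
  rw [h, abs_of_pos (inv_pos.2 hσ), smul_eq_mul, ← integral_const_mul]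
  congr 1 with x
  ring

/-- The rule δ_H*(x) = exp(2a*x/σ)/(exp(2a*x/σ)+1) is minimax optimal in terms of mean
square regret for the two-dimensional partially identified problem. -/
theorem stmt_9 (σ k τstar astar : ℝ) (hσ : 0 < σ) (hk : 0 < k)
    (hτ0 : 0 ≤ τstar)
    (hτmax : ∀ τ : ℝ, 0 ≤ τ → τ ^ 2 * ρ τ ≤ τstar ^ 2 * ρ τstar)
    (ha : astar ∈ Set.Icc 0 τstar)
    (hamax : ∀ a ∈ Set.Icc 0 τstar,
      (a + k / σ) ^ 2 * ρ a ≤ (astar + k / σ) ^ 2 * ρ astar)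
    (δH : ℝ → ℝ)
    (hδH : ∀ x, δH x =
      Real.exp (2 * astar * x / σ) / (Real.exp (2 * astar * x / σ) + 1)) :
    ∀ δ : ℝ → ℝ, Measurable δ → (∀ x, δ x ∈ Set.Icc (0 : ℝ) 1) →
      (⨆ p : Θset k, ENNReal.ofReal (Rsq σ δH p.1.1 p.1.2)) ≤
        ⨆ p : Θset k, ENNReal.ofReal (Rsq σ δ p.1.1 p.1.2) := by
  intro δ hδm hδ
  have ha0 := ha.1
  have hc : 0 < k / σ := div_pos hk hσ
  have hδHy (y : ℝ) : δH (σ * y) =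
      Real.exp (2 * astar * y) / (Real.exp (2 * astar * y) + 1) := by
    have : 2 * astar * (σ * y) / σ = 2 * astar * y := by field_simp
    rw [hδH, this]
  have upper (s t : ℝ) (hs : 0 ≤ s) (hst : s - k / σ ≤ t) :
      s ^ 2 * logisticRisk astar t ≤ (astar + k / σ) ^ 2 * ρ astar := by
    refine (mul_le_mul_of_nonneg_left (logisticRisk_antitone ha0 hst) (sq_nonneg s)).trans ?_
    simpa using sq_mul_logisticRisk_le hc hτ0 hτmax ha hamax (t := s - k / σ) (by linarith)
  have hV : ∀ p ∈ Θset k, Rsq σ δH p.1 p.2 ≤ σ ^ 2 * ((astar + k / σ) ^ 2 * ρ astar) := by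
    rintro ⟨e, t⟩ ⟨h1, h2⟩
    simp only at h1 h2 ⊢
    rw [Rsq_eq hσ]
    simp only [hδHy]
    have ht : t ^ 2 = σ ^ 2 * (t / σ) ^ 2 := by field_simp
    rw [ht, mul_assoc]
    refine mul_le_mul_of_nonneg_left ?_ (sq_nonneg σ)
    split_ifs with h
    · simp only [one_sub_logistic_sq]
      refine upper (t / σ) (e / σ) (by positivity) ?_
      rw [← sub_div]
      gcongr
      linarith
    · simp only [zero_sub, neg_sq, logistic_sq]
      have hI := integral_neg_logisticRisk astar (-(e / σ))
      simp only [← sub_eq_add_neg] at hI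
      rw [hI, ← neg_sq]
      refine upper _ _ (by rw [← neg_div]; exact div_nonneg (by linarith) hσ.le) ?_
      rw [← neg_div, ← neg_div, ← sub_div]
      gcongr
      linarith
  have hpos : 0 < σ * astar + k := by positivity
  let P : Θset k := ⟨(σ * astar, σ * astar + k), by
    constructor <;> dsimp only <;> linarith⟩
  let Q : Θset k := ⟨(-(σ * astar), -(σ * astar + k)), by
    constructor <;> dsimp only <;> linarith⟩
  have hsum : 2 * (σ ^ 2 * ((astar + k / σ) ^ 2 * ρ astar)) ≤
      Rsq σ δ P.1.1 P.1.2 + Rsq σ δ Q.1.1 Q.1.2 := by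
    simp only [P, Q]
    rw [Rsq_eq hσ, Rsq_eq hσ, if_pos hpos.le, if_neg (by linarith)]
    have hb := two_mul_rho_le (δ := fun y => δ (σ * y))
      (hδm.comp (measurable_const_mul σ)) (fun y => hδ _) astar
    have e1 : σ * astar / σ = astar := by field_simp
    simp only [neg_div, e1, sub_neg_eq_add, zero_sub, neg_sq]
    rw [← mul_add]
    have e2 : σ ^ 2 * (astar + k / σ) ^ 2 = (σ * astar + k) ^ 2 := by field_simp
    calc _ = (σ ^ 2 * (astar + k / σ) ^ 2) * (2 * ρ astar) := by ring
      _ = (σ * astar + k) ^ 2 * (2 * ρ astar) := by rw [e2]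
      _ ≤ _ := mul_le_mul_of_nonneg_left hb (sq_nonneg _)
  refine iSup_le fun p => (ENNReal.ofReal_le_ofReal (hV p.1 p.2)).trans ?_
  rcases le_total (Rsq σ δ P.1.1 P.1.2) (Rsq σ δ Q.1.1 Q.1.2) with h | h
  · exact (ENNReal.ofReal_le_ofReal (by linarith)).trans
      (le_iSup (fun p : Θset k => ENNReal.ofReal (Rsq σ δ p.1.1 p.1.2)) Q)
  · exact (ENNReal.ofReal_le_ofReal (by linarith)).trans
      (le_iSup (fun p : Θset k => ENNReal.ofReal (Rsq σ δ p.1.1 p.1.2)) P)
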